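/- Let f define an invariant torus of B, let x₀ = f(u₀,v₀), and let v ∈ ℝ³ lie in the span of ∂_u f(u₀,v₀) and ∂_v f(u₀,v₀) (the tangent plane to the torus at x₀). Then for every t ∈ ℝ and every (u,v') with f(u,v') = x(t), the vector M(t)·v lies in the span of ∂_u f(u,v') and ∂_v f(u,v'); i.e., the linearized field-line flow maps tangent planes of an invariant torus to tangent planes. -/

import Mathlib

/-- `f : ℝ² → ℝ³` defines an invariant torus of the vector field `B`: it is C¹,
doubly periodic with period 1, injective on a fundamental domain, an immersion,
and `B` is everywhere tangent to it. -/
def IsInvariantTorus (B : (Fin 3 → ℝ) → (Fin 3 → ℝ))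
    (f : ℝ × ℝ → Fin 3 → ℝ) : Prop :=
  ContDiff ℝ 1 f ∧
  (∀ u v : ℝ, f (u + 1, v) = f (u, v) ∧ f (u, v + 1) = f (u, v)) ∧
  Set.InjOn f (Set.Ico (0:ℝ) 1 ×ˢ Set.Ico (0:ℝ) 1) ∧
  (∀ p : ℝ × ℝ, LinearIndependent ℝ ![fderiv ℝ f p (1, 0), fderiv ℝ f p (0, 1)]) ∧
  (∀ p : ℝ × ℝ,
    B (f p) ∈ Submodule.span ℝ {fderiv ℝ f p (1, 0), fderiv ℝ f p (0, 1)})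

section
open Filter Topology Set Metric Asymptotics

theorem infDist_isLittleO {E : Type*} [NormedAddCommGroup E] [NormedSpace ℝ E] [ProperSpace E]
    (B : E → E) (hB : ContDiff ℝ 1 B) (S : Set E) (hS : IsCompact S) (hne : S.Nonempty)
    (hcurve : ∀ q ∈ S, ∃ c : ℝ → E, (∀ h, c h ∈ S) ∧ c 0 = q ∧ HasDerivAt c (B q) 0)
    (x v : ℝ → E) (hx : ∀ t, HasDerivAt x (B (x t)) t)
    (hv : ∀ t, HasDerivAt v (fderiv ℝ B (x t) (v t)) t) (T : ℝ) (hT : 0 ≤ T)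
    (h0 : (fun s : ℝ => infDist (x 0 + s • v 0) S) =o[𝓝[>] 0] (fun s : ℝ => s)) :
    (fun s : ℝ => infDist (x T + s • v T) S) =o[𝓝[>] 0] (fun s : ℝ => s) := by
  have hxc : Continuous x := continuous_iff_continuousAt.2 fun t => (hx t).continuousAt
  have hvc : Continuous v := continuous_iff_continuousAt.2 fun t => (hv t).continuousAt
  have hDc : Continuous (fderiv ℝ B) := hB.continuous_fderiv one_ne_zero
  have hBd : Differentiable ℝ B := hB.differentiable one_ne_zero
  obtain ⟨R, hR⟩ : ∃ R, ((fun p : ℝ × ℝ => x p.1 + p.2 • v p.1) '' (Icc 0 T ×ˢ Icc 0 1)) ∪ S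
      ⊆ closedBall (0:E) R :=
    (((isCompact_Icc.prod isCompact_Icc).image (by fun_prop)).union hS).isBounded.subset_closedBall 0
  have hRz : ∀ t ∈ Icc 0 T, ∀ s ∈ Icc (0:ℝ) 1, x t + s • v t ∈ closedBall (0:E) R :=
    fun t ht s hs => hR (Or.inl ⟨(t, s), ⟨ht, hs⟩, rfl⟩)
  have hRS : ∀ q ∈ S, q ∈ closedBall (0:E) R := fun q hq => hR (Or.inr hq)
  obtain ⟨V, hV⟩ := (isCompact_Icc (a := (0:ℝ)) (b := T)).exists_bound_of_continuousOn
    hvc.continuousOn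
  obtain ⟨L, hL⟩ := (isCompact_closedBall (0:E) R).exists_bound_of_continuousOn
    hDc.continuousOn
  have huc := (isCompact_closedBall (0:E) R).uniformContinuousOn_of_continuous hDc.continuousOn
  rw [Metric.uniformContinuousOn_iff] at huc
  have hV0 : 0 ≤ V := (norm_nonneg _).trans (hV 0 ⟨le_rfl, hT⟩)
  have hL0 : 0 ≤ L := (norm_nonneg _).trans (hL _ (hRz 0 ⟨le_rfl, hT⟩ 0 ⟨le_rfl, zero_le_one⟩))
  set K := L + 1 with hK
  rw [isLittleO_iff] at h0 ⊢
  intro c hc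
  set ε := c / (2 * Real.exp (K * T)) with hε
  have hεpos : 0 < ε := by positivity
  obtain ⟨δ, hδ, hδ'⟩ := huc (ε / (V + 1)) (by positivity)
  have e1 : ∀ᶠ s : ℝ in 𝓝[>] 0, s < δ / (V + 1) :=
    mem_nhdsWithin_of_mem_nhds (Iio_mem_nhds (by positivity))
  have e2 : ∀ᶠ s : ℝ in 𝓝[>] 0, s < 1 :=
    mem_nhdsWithin_of_mem_nhds (Iio_mem_nhds (by positivity))
  filter_upwards [h0 hεpos, e1, e2, self_mem_nhdsWithin] with s hs0 hs1 hs2 (hs3 : 0 < s)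
  have hs01 : s ∈ Icc (0:ℝ) 1 := ⟨hs3.le, hs2.le⟩
  rw [Real.norm_of_nonneg infDist_nonneg, Real.norm_of_nonneg hs3.le] at *
  have hzd : ∀ t, HasDerivAt (fun t => x t + s • v t) (B (x t) + s • fderiv ℝ B (x t) (v t)) t :=
    fun t => (hx t).add ((hv t).const_smul s)
  have hdef : ∀ t ∈ Icc 0 T,
      ‖B (x t) + s • fderiv ℝ B (x t) (v t) - B (x t + s • v t)‖ ≤ ε * s := by
    intro t ht
    have hxR : x t ∈ closedBall (0:E) R := by
      simpa using hRz t ht 0 ⟨le_rfl, zero_le_one⟩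
    have hnorm : ‖s • v t‖ ≤ s * (V + 1) := by
      rw [norm_smul, Real.norm_of_nonneg hs3.le]
      have := hV t ht
      gcongr; linarith
    have hlt : ‖s • v t‖ < δ := hnorm.trans_lt (by rwa [lt_div_iff₀ (by positivity)] at hs1)
    have := (convex_segment (𝕜 := ℝ) (x t) (x t + s • v t)).norm_image_sub_le_of_norm_fderiv_le'
      (f := B) (φ := fderiv ℝ B (x t)) (C := ε / (V + 1)) (fun y _ => hBd y) (fun y hy => by
        rw [← dist_eq_norm]
        refine (hδ' _ ?_ _ hxR ?_).le
        · exact (convex_closedBall (0:E) R).segment_subset hxR (hRz t ht s hs01) hy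
        · have := segment_subset_closedBall_left (x t) (x t + s • v t) hy
          rw [mem_closedBall] at this
          refine this.trans_lt ?_
          simpa [dist_eq_norm] using hlt)
      (left_mem_segment _ _ _) (right_mem_segment _ _ _)
    rw [add_sub_cancel_left, map_smul] at this
    rw [← norm_neg]
    calc _ = ‖B (x t + s • v t) - B (x t) - s • fderiv ℝ B (x t) (v t)‖ := by congr 1; abel
      _ ≤ _ := this
      _ ≤ ε / (V + 1) * (s * (V + 1)) := by gcongr
      _ = ε * s := by field_simp
  have hzc : Continuous (fun t => x t + s • v t) := by fun_prop
  have key := le_gronwallBound_of_liminf_deriv_right_le (f := fun t => infDist (x t + s • v t) S)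
    (f' := fun t => K * infDist (x t + s • v t) S + ε * s) (δ := ε * s) (K := K) (ε := ε * s)
    (a := 0) (b := T) ((continuous_infDist_pt S).comp hzc).continuousOn ?_ hs0
    (fun _ _ => le_rfl) T ⟨hT, le_rfl⟩
  · have hK1 : 1 ≤ K := by linarith
    rw [gronwallBound_of_K_ne_0 (by positivity), sub_zero] at key
    beta_reduce at key
    refine key.trans ?_
    have h1 : ε * s / K ≤ ε * s := div_le_self (by positivity) hK1
    have h2 : 1 ≤ Real.exp (K * T) := Real.one_le_exp (by positivity)
    calc _ ≤ ε * s * Real.exp (K * T) + ε * s * (Real.exp (K * T) - 1) := by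
          have : 0 ≤ Real.exp (K * T) - 1 := by linarith
          gcongr
      _ ≤ ε * s * Real.exp (K * T) + ε * s * Real.exp (K * T) := by
          gcongr; linarith
      _ = c * s := by rw [hε]; field_simp; ring
  · intro t ht r hr
    have ht' : t ∈ Icc 0 T := ⟨ht.1, ht.2.le⟩
    obtain ⟨q, hq, hdq⟩ := hS.exists_infDist_eq_dist hne (x t + s • v t)
    obtain ⟨γ, hγS, hγ0, hγ⟩ := hcurve q hq
    have hγ' : HasDerivAt (fun h => γ (h - t)) (B q) t := by
      have : HasDerivAt γ (B q) (t - t) := by simpa using hγ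
      exact HasDerivAt.comp_sub_const t t this
    have hg := (hzd t).sub hγ'
    have hlip : ‖B (x t + s • v t) - B q‖ ≤ L * ‖(x t + s • v t) - q‖ :=
      (convex_closedBall (0:E) R).norm_image_sub_le_of_norm_fderiv_le (fun y _ => hBd y) hL
        (hRS q hq) (hRz t ht' s hs01)
    have hlt : ‖B (x t) + s • fderiv ℝ B (x t) (v t) - B q‖ < r := by
      refine lt_of_le_of_lt ?_ hr
      have h3 := norm_add_le (B (x t) + s • fderiv ℝ B (x t) (v t) - B (x t + s • v t))
        (B (x t + s • v t) - B q)
      rw [sub_add_sub_cancel] at h3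
      have h4 := hdef t ht'
      have h5 : 0 ≤ ‖(x t + s • v t) - q‖ := norm_nonneg _
      simp only [hdq, dist_eq_norm]
      rw [hK]
      linarith
    refine (hg.hasDerivWithinAt.liminf_right_slope_norm_le hlt).mp ?_
    filter_upwards [self_mem_nhdsWithin] with h (hh : t < h) hlt
    refine lt_of_le_of_lt ?_ hlt
    have hpos : 0 ≤ (h - t)⁻¹ := inv_nonneg.2 (by linarith)
    refine mul_le_mul_of_nonneg_left ?_ hpos
    have h6 : infDist (x h + s • v h) S ≤ ‖x h + s • v h - γ (h - t)‖ := by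
      rw [← dist_eq_norm]; exact infDist_le_dist_of_mem (hγS _)
    have h7 : infDist (x t + s • v t) S = ‖x t + s • v t - γ (t - t)‖ := by
      rw [sub_self, hγ0, hdq, dist_eq_norm]
    simp only [Pi.sub_apply] at *
    linarith

theorem torus_int (f : ℝ × ℝ → Fin 3 → ℝ)
    (hp : ∀ u v : ℝ, f (u + 1, v) = f (u, v) ∧ f (u, v + 1) = f (u, v)) (u v : ℝ) (n m : ℤ) :
    f (u - n, v - m) = f (u, v) := by
  have h1 : ∀ v, Function.Periodic (fun u => f (u, v)) 1 := fun v u => (hp u v).1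
  have h2 : ∀ u, Function.Periodic (fun v => f (u, v)) 1 := fun u v => (hp u v).2
  have a := (h1 (v - m)).sub_int_mul_eq (x := u) n
  have b := (h2 u).sub_int_mul_eq (x := v) m
  simp only [mul_one] at a b
  rw [a, b]

theorem torus_inj (f : ℝ × ℝ → Fin 3 → ℝ)
    (hp : ∀ u v : ℝ, f (u + 1, v) = f (u, v) ∧ f (u, v + 1) = f (u, v))
    (hi : Set.InjOn f (Set.Ico (0:ℝ) 1 ×ˢ Set.Ico (0:ℝ) 1)) (p q : ℝ × ℝ) (h : f p = f q) :
    ∃ n m : ℤ, p.1 - q.1 = n ∧ p.2 - q.2 = m := by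
  have e : ∀ p : ℝ × ℝ, f (Int.fract p.1, Int.fract p.2) = f p :=
    fun p => torus_int f hp p.1 p.2 _ _
  have := hi (x₁ := (Int.fract p.1, Int.fract p.2)) (x₂ := (Int.fract q.1, Int.fract q.2))
    ⟨⟨Int.fract_nonneg _, Int.fract_lt_one _⟩, ⟨Int.fract_nonneg _, Int.fract_lt_one _⟩⟩
    ⟨⟨Int.fract_nonneg _, Int.fract_lt_one _⟩, ⟨Int.fract_nonneg _, Int.fract_lt_one _⟩⟩
    (by rw [e, e, h])
  rw [Prod.mk.injEq, Int.fract_eq_fract, Int.fract_eq_fract] at this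
  obtain ⟨⟨n, hn⟩, ⟨m, hm⟩⟩ := this
  exact ⟨n, m, hn, hm⟩

theorem torus_square (f : ℝ × ℝ → Fin 3 → ℝ)
    (hp : ∀ u v : ℝ, f (u + 1, v) = f (u, v) ∧ f (u, v + 1) = f (u, v)) (q p : ℝ × ℝ) :
    ∃ p' ∈ closedBall q (1/2), f p' = f p := by
  refine ⟨(p.1 - round (p.1 - q.1), p.2 - round (p.2 - q.2)), ?_, torus_int f hp _ _ _ _⟩
  rw [mem_closedBall, Prod.dist_eq, max_le_iff, Real.dist_eq, Real.dist_eq]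
  constructor
  · have := abs_sub_round (p.1 - q.1)
    rwa [sub_right_comm] at this
  · have := abs_sub_round (p.2 - q.2)
    rwa [sub_right_comm] at this

theorem span_eq_range (D : ℝ × ℝ →L[ℝ] (Fin 3 → ℝ)) (y : Fin 3 → ℝ) :
    y ∈ Submodule.span ℝ {D (1, 0), D (0, 1)} ↔ ∃ a, D a = y := by
  rw [Submodule.mem_span_pair]
  have key : ∀ a b : ℝ, D (a, b) = a • D (1, 0) + b • D (0, 1) := fun a b => by
    rw [← map_smul, ← map_smul, ← map_add]; simp
  constructor
  · rintro ⟨a, b, h⟩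
    exact ⟨(a, b), by rw [key, h]⟩
  · rintro ⟨⟨a, b⟩, h⟩
    exact ⟨a, b, by rw [← key, h]⟩

theorem torus_tangent (f : ℝ × ℝ → Fin 3 → ℝ) (hf : ContDiff ℝ 1 f)
    (hp : ∀ u v : ℝ, f (u + 1, v) = f (u, v) ∧ f (u, v + 1) = f (u, v))
    (hi : Set.InjOn f (Set.Ico (0:ℝ) 1 ×ˢ Set.Ico (0:ℝ) 1)) (q : ℝ × ℝ)
    (hl : LinearIndependent ℝ ![fderiv ℝ f q (1, 0), fderiv ℝ f q (0, 1)])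
    (y : Fin 3 → ℝ)
    (h : (fun s : ℝ => infDist (f q + s • y) (range f)) =o[𝓝[>] 0] (fun s : ℝ => s)) :
    ∃ a, fderiv ℝ f q a = y := by
  set D := fderiv ℝ f q with hD
  have hfd : HasFDerivAt f D q := (hf.differentiable one_ne_zero q).hasFDerivAt
  have hrange : range f = f '' closedBall q (1/2) := by
    apply Subset.antisymm
    · rintro _ ⟨p, rfl⟩
      obtain ⟨p', h1, h2⟩ := torus_square f hp q p
      exact ⟨p', h1, h2⟩
    · exact image_subset_range _ _
  have hS : IsCompact (range f) := hrange ▸ (isCompact_closedBall q (1/2)).image hf.continuous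
  have hch : ∀ s : ℝ, ∃ p ∈ closedBall q (1/2),
      infDist (f q + s • y) (range f) = ‖f q + s • y - f p‖ := by
    intro s
    obtain ⟨z, hz, hz'⟩ := hS.exists_infDist_eq_dist ⟨f q, q, rfl⟩ (f q + s • y)
    rw [hrange] at hz
    obtain ⟨p, hp, rfl⟩ := hz
    exact ⟨p, hp, by rw [hz', dist_eq_norm]⟩
  choose p hpb hpd using hch
  simp only [hpd] at h
  have h1 : (fun s : ℝ => f q + s • y - f (p s)) =o[𝓝[>] 0] (fun s : ℝ => s) :=
    isLittleO_norm_left.1 h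
  have hid : Tendsto (fun s : ℝ => s) (𝓝[>] 0) (𝓝 0) := tendsto_nhdsWithin_of_tendsto_nhds tendsto_id
  have hsy : Tendsto (fun s : ℝ => f q + s • y) (𝓝[>] 0) (𝓝 (f q)) := by
    simpa using tendsto_const_nhds.add (hid.smul_const y)
  have hfp : Tendsto (fun s => f (p s)) (𝓝[>] 0) (𝓝 (f q)) := by
    simpa using hsy.sub (h1.trans_tendsto hid)
  have hpq : Tendsto p (𝓝[>] 0) (𝓝 q) := by
    refine (isCompact_closedBall q (1/2)).tendsto_nhds_of_unique_mapClusterPt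
      (Eventually.of_forall hpb) fun z hz hcl => ?_
    have hcl' : MapClusterPt (f z) (𝓝[>] (0:ℝ)) (f ∘ p) :=
      hcl.continuousAt_comp hf.continuous.continuousAt
    have hzq : f z = f q := by
      have : (𝓝 (f z) ⊓ map (f ∘ p) (𝓝[>] (0:ℝ))).NeBot := hcl'
      have h2 : (𝓝 (f z) ⊓ 𝓝 (f q)).NeBot := this.mono (inf_le_inf_left _ hfp)
      exact eq_of_nhds_neBot h2
    obtain ⟨n, m, hn, hm⟩ := torus_inj f hp hi z q hzq
    rw [mem_closedBall, Prod.dist_eq, max_le_iff, Real.dist_eq, Real.dist_eq, hn, hm] at hz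
    have hz0 : ∀ k : ℤ, |(k:ℝ)| ≤ 1/2 → k = 0 := by
      intro k hk
      have : |(k:ℝ)| < 1 := by linarith
      exact Int.abs_lt_one_iff.1 (by exact_mod_cast this)
    rw [hz0 n hz.1] at hn
    rw [hz0 m hz.2] at hm
    ext
    · simpa [sub_eq_zero] using hn
    · simpa [sub_eq_zero] using hm
  have hker : LinearMap.ker (D : ℝ × ℝ →ₗ[ℝ] (Fin 3 → ℝ)) = ⊥ := by
    rw [LinearMap.ker_eq_bot']
    rintro ⟨a, b⟩ hab
    have := LinearIndependent.pair_iff.1 hl a b (by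
      rw [← map_smul, ← map_smul, ← map_add]
      simpa using hab)
    simp [this.1, this.2]
  obtain ⟨C, -, hC⟩ := LinearMap.exists_antilipschitzWith _ hker
  have hrev : (fun x' => x' - q) =O[𝓝 q] fun x' => f x' - f q := 
    (hfd.isTheta_sub (hC.isInducing D.continuous)).isBigO_symm
  have h2 : (fun s => f (p s) - f q) =O[𝓝[>] 0] (fun s : ℝ => s) := by
    have a : (fun s : ℝ => s • y) =O[𝓝[>] 0] (fun s : ℝ => s) := by
      refine IsBigO.of_bound ‖y‖ (Eventually.of_forall fun s => ?_)
      rw [norm_smul, mul_comm]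
    refine (a.sub h1.isBigO).congr_left fun s => ?_
    abel
  have h3 : (fun s => p s - q) =O[𝓝[>] 0] (fun s : ℝ => s) := (hrev.comp_tendsto hpq).trans h2
  have h4 : (fun s => f (p s) - f q - D (p s - q)) =o[𝓝[>] 0] (fun s : ℝ => s) :=
    ((hasFDerivAt_iff_isLittleO.1 hfd).comp_tendsto hpq).trans_isBigO h3
  have h5 : (fun s : ℝ => s • y - D (p s - q)) =o[𝓝[>] 0] (fun s : ℝ => s) := by
    refine (h1.add h4).congr_left fun s => ?_
    abel
  have h6 : Tendsto (fun s : ℝ => s⁻¹ • (s • y - D (p s - q))) (𝓝[>] 0) (𝓝 0) := by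
    have := h5.tendsto_inv_smul_nhds_zero
    exact this
  have h7 : Tendsto (fun s : ℝ => D (s⁻¹ • (p s - q))) (𝓝[>] 0) (𝓝 y) := by
    have h8 : Tendsto (fun s : ℝ => y - s⁻¹ • (s • y - D (p s - q))) (𝓝[>] 0) (𝓝 (y - 0)) :=
      tendsto_const_nhds.sub h6
    rw [sub_zero] at h8
    refine h8.congr' ?_
    filter_upwards [self_mem_nhdsWithin] with s (hs : 0 < s)
    rw [smul_sub, smul_smul, inv_mul_cancel₀ hs.ne', one_smul, map_smul, sub_sub_cancel]
  have hcl : IsClosed (range D) := by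
    have := (LinearMap.range (D : ℝ × ℝ →ₗ[ℝ] (Fin 3 → ℝ))).closed_of_finiteDimensional
    exact this
  exact hcl.mem_of_tendsto h7 (Eventually.of_forall fun s => ⟨_, rfl⟩)

theorem forward_case
    (B : (Fin 3 → ℝ) → (Fin 3 → ℝ))
    (JB : (Fin 3 → ℝ) → Matrix (Fin 3) (Fin 3) ℝ)
    (x : ℝ → Fin 3 → ℝ)
    (M : ℝ → Matrix (Fin 3) (Fin 3) ℝ)
    (hB : ContDiff ℝ 1 B)
    (hJB : ∀ p, HasFDerivAt B (LinearMap.toContinuousLinearMap (Matrix.mulVecLin (JB p))) p)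
    (hx : ∀ t, HasDerivAt x (B (x t)) t)
    (hM : ∀ t i j, HasDerivAt (fun s => M s i j) ((JB (x t) * M t) i j) t)
    (hM0 : M 0 = 1)
    (f : ℝ × ℝ → Fin 3 → ℝ)
    (hf : IsInvariantTorus B f)
    (p₀ : ℝ × ℝ) (hx₀ : f p₀ = x 0)
    (w : Fin 3 → ℝ)
    (hw : ∃ a, fderiv ℝ f p₀ a = w) (t : ℝ) (ht : 0 ≤ t) (q : ℝ × ℝ) (hq : f q = x t) :
    ∃ a, fderiv ℝ f q a = (M t).mulVec w := by
  obtain ⟨hf1, hp, hi, hl, ht'⟩ := hf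
  have hline : ∀ (p a : ℝ × ℝ), HasDerivAt (fun h : ℝ => f (p + h • a)) (fderiv ℝ f p a) 0 := by
    intro p a
    have h1 : HasDerivAt (fun h : ℝ => p + h • a) a 0 := by
      simpa using ((hasDerivAt_id (0:ℝ)).smul_const a).const_add p
    have h2 : HasFDerivAt f (fderiv ℝ f p) (p + (0:ℝ) • a) := by
      simpa using (hf1.differentiable one_ne_zero p).hasFDerivAt
    exact h2.comp_hasDerivAt (0:ℝ) h1
  refine torus_tangent f hf1 hp hi q (hl q) _ ?_
  rw [hq]
  have hrange : range f = f '' closedBall q (1/2) := by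
    apply Subset.antisymm
    · rintro _ ⟨p, rfl⟩
      obtain ⟨p', h1, h2⟩ := torus_square f hp q p
      exact ⟨p', h1, h2⟩
    · exact image_subset_range _ _
  have hS : IsCompact (range f) := hrange ▸ (isCompact_closedBall q (1/2)).image hf1.continuous
  refine infDist_isLittleO B hB (range f) hS ⟨f q, q, rfl⟩ ?_ x (fun t => (M t).mulVec w) hx ?_ t ht ?_
  · rintro _ ⟨p, rfl⟩
    obtain ⟨a, ha⟩ := (span_eq_range _ _).1 (ht' p)
    exact ⟨fun h => f (p + h • a), fun h => ⟨_, rfl⟩, by simp, ha ▸ hline p a⟩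
  · intro t
    rw [(hJB (x t)).fderiv]
    have : (LinearMap.toContinuousLinearMap (Matrix.mulVecLin (JB (x t)))) ((M t).mulVec w)
        = (JB (x t) * M t).mulVec w := by
      simp [Matrix.mulVec_mulVec]
    rw [this, hasDerivAt_pi]
    intro i
    simp only [Matrix.mulVec, dotProduct]
    exact HasDerivAt.fun_sum fun j _ => (hM t i j).mul_const (w j)
  · obtain ⟨a, ha⟩ := hw
    have h1 := (hasDerivAt_iff_isLittleO.1 (hline p₀ a))
    simp only [sub_zero, zero_smul, add_zero, ha, hx₀] at h1
    refine IsBigO.trans_isLittleO (IsBigO.of_bound 1 (Eventually.of_forall fun s => ?_))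
      (h1.mono nhdsWithin_le_nhds)
    rw [hM0, Matrix.one_mulVec, Real.norm_of_nonneg infDist_nonneg, one_mul]
    refine (infDist_le_dist_of_mem (mem_range_self (p₀ + s • a))).trans ?_
    rw [dist_comm, dist_eq_norm, sub_add_eq_sub_sub]

end

/-- The linearized field-line flow maps tangent planes of an invariant
torus to tangent planes: if `w` is tangent to the torus at `x₀ = f(u₀,v₀)` and
`f(u,v') = x(t)`, then `M(t)·w` is tangent to the torus at `x(t)`. -/
theorem linearized_flow_maps_tangent_planes
    (B : (Fin 3 → ℝ) → (Fin 3 → ℝ))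
    (JB : (Fin 3 → ℝ) → Matrix (Fin 3) (Fin 3) ℝ)
    (x : ℝ → Fin 3 → ℝ) (x₀ : Fin 3 → ℝ)
    (M : ℝ → Matrix (Fin 3) (Fin 3) ℝ)
    (hB : ContDiff ℝ 1 B)
    (hJB : ∀ p, HasFDerivAt B (LinearMap.toContinuousLinearMap (Matrix.mulVecLin (JB p))) p)
    (hx : ∀ t, HasDerivAt x (B (x t)) t) (hx0 : x 0 = x₀)
    (hM : ∀ t i j, HasDerivAt (fun s => M s i j) ((JB (x t) * M t) i j) t)
    (hM0 : M 0 = 1)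
    (f : ℝ × ℝ → Fin 3 → ℝ)
    (hf : IsInvariantTorus B f)
    (u₀ v₀ : ℝ) (hx₀ : f (u₀, v₀) = x₀)
    (w : Fin 3 → ℝ)
    (hw : w ∈ Submodule.span ℝ
        {fderiv ℝ f (u₀, v₀) (1, 0), fderiv ℝ f (u₀, v₀) (0, 1)}) :
    ∀ (t u v' : ℝ), f (u, v') = x t →
      (M t).mulVec w ∈ Submodule.span ℝ
        {fderiv ℝ f (u, v') (1, 0), fderiv ℝ f (u, v') (0, 1)} := by
  intro t u v' h
  rw [span_eq_range] at hw ⊢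
  subst hx0
  rcases le_total 0 t with ht | ht
  · exact forward_case B JB x M hB hJB hx hM hM0 f hf (u₀, v₀) hx₀ w hw t ht (u, v') h
  · have := forward_case (fun y => - B y) (fun y => - JB y) (fun s => x (-s)) (fun s => M (-s))
      hB.neg (fun p => ?_) (fun s => ?_) (fun s i j => ?_) (by simpa using hM0) f ?_
      (u₀, v₀) (by simpa using hx₀) w hw (-t) (by linarith) (u, v') (by simpa using h)
    · simpa using this
    · have := (hJB p).neg
      convert! this using 1
      ext y i
      simp
    · simpa [Function.comp_def] using (hx (-s)).scomp s (hasDerivAt_neg s)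
    · simpa [Function.comp_def] using (hM (-s) i j).scomp s (hasDerivAt_neg s)
    · obtain ⟨h1, h2, h3, h4, h5⟩ := hf
      exact ⟨h1, h2, h3, h4, fun p => Submodule.neg_mem _ (h5 p)⟩
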